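/- Let m be odd, a ∈ F_r^* with Tr(a^{-1}) ≠ 0, and ρ ∈ F_p^*. Then the triple exponential sum Σ_{z ∈ F_p^*} Σ_{y ∈ F_p} Σ_{x ∈ F_r} ζ_p^{Tr(azx² + yx) − zρ} equals −(-1)^{((p-1)/2)·((m-1)/2)} · η(a) · η̄(Tr(a^{-1})) · p^{(m+1)/2} (as a complex number). -/

import Mathlib

/-- `ζ_p ^ c` for `c ∈ F_p`: `exp(2πi·c̃/p)` where `c̃` is the integer representative. -/
noncomputable def zetaP (p : ℕ) (c : ZMod p) : ℂ :=
  Complex.exp (2 * Real.pi * Complex.I * (c.val : ℂ) / (p : ℂ))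

open Finset

/-- The quadratic character of a finite field, with complex values. -/
noncomputable def complexQuadraticChar (K : Type*) [Field K] [Fintype K] [DecidableEq K] :
    MulChar K ℂ :=
  (quadraticChar K).ringHomComp (Int.castRingHom ℂ)

section GaussSum

variable {K : Type*} [Field K] [Fintype K]

theorem sum_addChar_mul_sq [DecidableEq K] (hK : ringChar K ≠ 2) {ψ : AddChar K ℂ}
    (hψ : ψ ≠ 1) {b : K} (hb : b ≠ 0) :
    ∑ x : K, ψ (b * x ^ 2) = (quadraticChar K b : ℂ) * gaussSum (complexQuadraticChar K) ψ := by
  have fibers : ∑ x : K, ψ (b * x ^ 2) = ∑ t : K, ((quadraticChar K t : ℂ) + 1) * ψ (b * t) := by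
    rw [← sum_fiberwise univ (fun x : K => x ^ 2)]
    refine sum_congr rfl fun t _ => ?_
    have hcongr : ∀ x ∈ univ.filter (fun x : K => x ^ 2 = t), ψ (b * x ^ 2) = ψ (b * t) := by
      intro x hx
      rw [(mem_filter.mp hx).2]
    rw [sum_congr rfl hcongr, sum_const, nsmul_eq_mul]
    have hcount := quadraticChar_card_sqrts hK t
    rw [Set.toFinset_ofPred] at hcount
    congr 1
    exact_mod_cast hcount
  have hzero : ∑ t : K, ψ (b * t) = 0 := by
    have := AddChar.sum_eq_zero_of_ne_one (AddChar.IsPrimitive.of_ne_one hψ hb)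
    simpa [AddChar.mulShift_apply] using this
  have hshift := gaussSum_mulShift (complexQuadraticChar K) ψ (Units.mk0 b hb)
  have hsq : (quadraticChar K b : ℂ) * quadraticChar K b = 1 := by
    have := quadraticChar_sq_one hb
    rw [← sq]
    exact_mod_cast this
  rw [fibers, ← hshift]
  simp only [add_mul, one_mul, sum_add_distrib, hzero, add_zero, Units.val_mk0, gaussSum,
    AddChar.mulShift_apply, complexQuadraticChar, MulChar.ringHomComp_apply, Int.coe_castRingHom]
  rw [← mul_assoc, hsq, one_mul]

theorem sum_addChar_quadratic (hK : ringChar K ≠ 2) (ψ : AddChar K ℂ) {b : K} (hb : b ≠ 0)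
    (c : K) :
    ∑ x : K, ψ (b * x ^ 2 + c * x) = ψ (-c ^ 2 / (4 * b)) * ∑ x : K, ψ (b * x ^ 2) := by
  have h2 : (2 : K) ≠ 0 := Ring.two_ne_zero hK
  have h4 : (4 : K) ≠ 0 := by
    have := mul_ne_zero h2 h2
    norm_num at this
    exact this
  rw [← Equiv.sum_comp (Equiv.addRight (c / (2 * b))) (fun x => ψ (b * x ^ 2)), mul_sum]
  refine sum_congr rfl fun x _ => ?_
  rw [← AddChar.map_add_eq_mul]
  congr 1
  simp only [Equiv.coe_addRight]
  field_simp
  ring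

theorem gaussSum_complexQuadraticChar_sq [DecidableEq K] (hK : ringChar K ≠ 2)
    {ψ : AddChar K ℂ} (hψ : ψ ≠ 1) :
    gaussSum (complexQuadraticChar K) ψ ^ 2 = (quadraticChar K (-1) : ℂ) * Fintype.card K := by
  have hne : complexQuadraticChar K ≠ 1 :=
    (MulChar.ringHomComp_ne_one_iff (Int.castRingHom ℂ).injective_int).mpr
      (quadraticChar_ne_one hK)
  exact gaussSum_sq hne ((quadraticChar_isQuadratic K).comp _) (.of_ne_one hψ)

end GaussSum

section OddDegree

variable {k : Type*} [Field k] {K : Type*} [Field K] [Fintype K] [Algebra k K]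

theorem quadraticChar_algebraMap_of_odd_finrank [Fintype k] [DecidableEq k] [DecidableEq K]
    (hodd : Odd (Module.finrank k K)) (c : k) :
    quadraticChar K (algebraMap k K c) = quadraticChar k c := by
  rcases eq_or_ne c 0 with rfl | hc
  · simp
  have hc' : algebraMap k K c ≠ 0 := by simpa using hc
  have hiff : IsSquare (algebraMap k K c) ↔ IsSquare c := by
    refine ⟨fun h => ?_, fun h => h.map (algebraMap k K)⟩
    have hpow := h.map (Algebra.norm k)
    rw [Algebra.norm_algebraMap] at hpow
    rw [← quadraticChar_one_iff_isSquare hc]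
    rw [← quadraticChar_one_iff_isSquare (pow_ne_zero _ hc), map_pow] at hpow
    rcases quadraticChar_dichotomy hc with h1 | h1
    · exact h1
    · rw [h1, hodd.neg_one_pow] at hpow
      norm_num at hpow
  rcases quadraticChar_dichotomy hc with h1 | h1
  · rw [h1, quadraticChar_one_iff_isSquare hc', hiff, ← quadraticChar_one_iff_isSquare hc, h1]
  · rw [h1, quadraticChar_neg_one_iff_not_isSquare, hiff,
      ← quadraticChar_neg_one_iff_not_isSquare, h1]

theorem isSquare_algebraMap_discr [Finite k] {ι : Type*} [Fintype ι] [DecidableEq ι]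
    (b : Module.Basis ι k K) : IsSquare (algebraMap k K (Algebra.discr k b)) := by
  have hcard : Fintype.card Gal(K/k) = Fintype.card ι := by
    rw [← Nat.card_eq_fintype_card, IsGalois.card_aut_eq_finrank, Module.finrank_eq_card_basis b]
  let e : ι ≃ Gal(K/k) := Fintype.equivOfCardEq hcard.symm
  let M : Matrix ι ι K := Matrix.of fun s i => e s (b i)
  have hM : (Algebra.traceMatrix k b).map (algebraMap k K) = M.transpose * M := by
    ext i j
    rw [Matrix.map_apply, Algebra.traceMatrix_apply, Algebra.traceForm_apply,
      trace_eq_sum_automorphisms, Matrix.mul_apply, ← Equiv.sum_comp e]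
    simp [M]
  refine ⟨M.det, ?_⟩
  rw [Algebra.discr_def, RingHom.map_det, RingHom.mapMatrix_apply, hM, Matrix.det_mul,
    Matrix.det_transpose]

/-- The Hasse–Davenport relation for the quadratic character in an extension of odd degree. -/
theorem sum_addChar_trace_sq_of_odd_finrank [Fintype k] [DecidableEq k] (hk : ringChar k ≠ 2)
    (hodd : Odd (Module.finrank k K)) {ψ : AddChar k ℂ} (hψ : ψ ≠ 1) :
    ∑ x : K, ψ (Algebra.trace k K (x ^ 2)) =
      gaussSum (complexQuadraticChar k) ψ ^ Module.finrank k K := by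
  classical
  have : Invertible (2 : k) := invertibleOfNonzero (Ring.two_ne_zero hk)
  set n := Module.finrank k K
  have hsymm : LinearMap.IsSymm (Algebra.traceForm k K) :=
    ⟨fun x y => by simp [Algebra.traceForm_apply, mul_comm]⟩
  obtain ⟨v, hv⟩ : ∃ v : Module.Basis (Fin n) k K, (Algebra.traceForm k K).IsOrthoᵢ v :=
    LinearMap.BilinForm.exists_orthogonal_basis hsymm
  rw [LinearMap.isOrthoᵢ_def] at hv
  let d : Fin n → k := fun i => Algebra.traceForm k K (v i) (v i)
  have hdiag : Algebra.traceMatrix k v = Matrix.diagonal d := by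
    ext i j
    rw [Algebra.traceMatrix_apply, Matrix.diagonal_apply]
    split_ifs with h
    · rw [← h]
    · exact hv i j h
  have hdiscr : Algebra.discr k v = ∏ i, d i := by
    rw [Algebra.discr_def, hdiag, Matrix.det_diagonal]
  have hdiscr0 : Algebra.discr k v ≠ 0 := Algebra.discr_not_zero_of_basis k v
  have hd : ∀ i, d i ≠ 0 := fun i => prod_ne_zero_iff.mp (hdiscr ▸ hdiscr0) i (mem_univ i)
  have hchar : ∏ i, quadraticChar k (d i) = 1 := by
    rw [← map_prod, ← hdiscr, ← quadraticChar_algebraMap_of_odd_finrank hodd,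
      quadraticChar_one_iff_isSquare (by simpa using hdiscr0)]
    exact isSquare_algebraMap_discr v
  have htrace : ∀ c : Fin n → k,
      Algebra.trace k K ((v.equivFun.symm c) ^ 2) = ∑ i, d i * c i ^ 2 := by
    intro c
    rw [sq, ← Algebra.traceForm_apply, Module.Basis.equivFun_symm_apply]
    simp only [map_sum, LinearMap.sum_apply, map_smul, LinearMap.smul_apply, smul_eq_mul]
    refine sum_congr rfl fun i _ => ?_
    rw [sum_eq_single i]
    · simp only [d]
      ring
    · intro j _ hj
      rw [hv j i hj, mul_zero]
    · simp
  calc ∑ x : K, ψ (Algebra.trace k K (x ^ 2))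
      = ∑ c : Fin n → k, ψ (Algebra.trace k K ((v.equivFun.symm c) ^ 2)) :=
        (Equiv.sum_comp v.equivFun.symm.toEquiv
          (fun x : K => ψ (Algebra.trace k K (x ^ 2)))).symm
    _ = ∑ c : Fin n → k, ∏ i, ψ (d i * c i ^ 2) := by
        refine sum_congr rfl fun c _ => ?_
        rw [htrace]
        exact map_prod ψ.toMonoidHom (fun i => Multiplicative.ofAdd (d i * c i ^ 2)) univ
    _ = ∏ i, ∑ t : k, ψ (d i * t ^ 2) := by
        rw [prod_univ_sum, Fintype.piFinset_univ]
    _ = ∏ i, ((quadraticChar k (d i) : ℂ) * gaussSum (complexQuadraticChar k) ψ) :=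
        prod_congr rfl fun i _ => sum_addChar_mul_sq hk hψ (hd i)
    _ = gaussSum (complexQuadraticChar k) ψ ^ n := by
        rw [prod_mul_distrib, prod_const, card_univ, Fintype.card_fin, ← Int.cast_prod, hchar,
          Int.cast_one, one_mul]

end OddDegree

theorem zetaP_eq_stdAddChar (p : ℕ) [NeZero p] (c : ZMod p) : zetaP p c = ZMod.stdAddChar c := by
  rw [ZMod.stdAddChar_apply, ZMod.toCircle_apply, zetaP]

theorem stdAddChar_zmod_ne_one (p : ℕ) [Fact p.Prime] :
    (ZMod.stdAddChar : AddChar (ZMod p) ℂ) ≠ 1 := by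
  have := ZMod.isPrimitive_stdAddChar p one_ne_zero
  rwa [AddChar.mulShift_one] at this

theorem stmt_7 (p m : ℕ) [Fact p.Prime] (hp2 : p ≠ 2) (hm : 2 ≤ m) (hmodd : Odd m)
    (F : Type) [Field F] [Fintype F] [DecidableEq F] [Algebra (ZMod p) F]
    (hcard : Fintype.card F = p ^ m)
    (a : F) (ha : a ≠ 0) (hTra : Algebra.trace (ZMod p) F a⁻¹ ≠ 0)
    (ρ : ZMod p) (hρ : ρ ≠ 0) :
    (∑ z ∈ Finset.univ.filter (fun z : ZMod p => z ≠ 0), ∑ y : ZMod p, ∑ x : F,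
        zetaP p (Algebra.trace (ZMod p) F
          (a * algebraMap (ZMod p) F z * x ^ 2 + algebraMap (ZMod p) F y * x) - z * ρ))
      = ((-((-1) ^ (((p - 1) / 2) * ((m - 1) / 2))) * quadraticChar F a
          * quadraticChar (ZMod p) (Algebra.trace (ZMod p) F a⁻¹)
          * (p : ℤ) ^ ((m + 1) / 2) : ℤ) : ℂ) := by
  have hfin : Module.finrank (ZMod p) F = m := by
    have h := Module.card_eq_pow_finrank (K := ZMod p) (V := F)
    rw [hcard, ZMod.card] at h
    exact (Nat.pow_right_injective (Fact.out : p.Prime).two_le h).symm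
  have hp : ringChar (ZMod p) ≠ 2 := by rwa [ZMod.ringChar_zmod_n]
  have hF : ringChar F ≠ 2 := by rwa [← Algebra.ringChar_eq (ZMod p) F]
  have hfinodd : Odd (Module.finrank (ZMod p) F) := hfin ▸ hmodd
  set T := Algebra.trace (ZMod p) F a⁻¹ with hT
  let ψ : AddChar (ZMod p) ℂ := ZMod.stdAddChar
  have hψ : ψ ≠ 1 := stdAddChar_zmod_ne_one p
  let ψF : AddChar F ℂ := ψ.compAddMonoidHom (Algebra.trace (ZMod p) F).toAddMonoidHom
  have hψF_apply : ∀ x, ψF x = ψ (Algebra.trace (ZMod p) F x) := fun x => rfl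
  have hψF : ψF ≠ 1 := by
    obtain ⟨c, hc⟩ := AddChar.ne_one_iff.mp hψ
    obtain ⟨x, rfl⟩ := Algebra.trace_surjective (ZMod p) F c
    exact AddChar.ne_one_iff.mpr ⟨x, hc⟩
  let g := gaussSum (complexQuadraticChar (ZMod p)) ψ
  have hG : gaussSum (complexQuadraticChar F) ψF = g ^ m := by
    have h1 := sum_addChar_mul_sq hF hψF one_ne_zero
    have h2 := sum_addChar_trace_sq_of_odd_finrank (K := F) hp hfinodd hψ
    simp only [one_mul, map_one, Int.cast_one, hψF_apply] at h1
    rw [← h1, h2, hfin]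
  have hinner : ∀ z ∈ univ.filter (fun z : ZMod p => z ≠ 0),
      ∑ y : ZMod p, ∑ x : F, zetaP p (Algebra.trace (ZMod p) F
          (a * algebraMap (ZMod p) F z * x ^ 2 + algebraMap (ZMod p) F y * x) - z * ρ)
        = ψ (-(z * ρ)) * ((quadraticChar F a * quadraticChar (ZMod p) (-T) : ℤ) * g ^ (m + 1)) := by
    intro z hz
    have hz0 : z ≠ 0 := (mem_filter.mp hz).2
    have hz0' : algebraMap (ZMod p) F z ≠ 0 := by simpa using hz0
    have h2 : (2 : ZMod p) ≠ 0 := Ring.two_ne_zero hp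
    have h4 : (4 : ZMod p) ≠ 0 := by
      have := mul_ne_zero h2 h2
      norm_num at this
      exact this
    have hx : ∀ y : ZMod p, ∑ x : F, zetaP p (Algebra.trace (ZMod p) F
          (a * algebraMap (ZMod p) F z * x ^ 2 + algebraMap (ZMod p) F y * x) - z * ρ)
        = ψ (-(z * ρ)) * (ψ (-T / (4 * z) * y ^ 2) *
            ((quadraticChar F a * quadraticChar (ZMod p) z : ℤ) * g ^ m)) := by
      intro y
      have hquad := sum_addChar_quadratic hF ψF (mul_ne_zero ha hz0') (algebraMap (ZMod p) F y)
      rw [sum_addChar_mul_sq hF hψF (mul_ne_zero ha hz0'), hG, map_mul (quadraticChar F),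
        quadraticChar_algebraMap_of_odd_finrank hfinodd] at hquad
      have harg : -(algebraMap (ZMod p) F y) ^ 2 / (4 * (a * algebraMap (ZMod p) F z))
          = (-y ^ 2 / (4 * z)) • a⁻¹ := by
        rw [Algebra.smul_def]
        simp only [map_div₀, map_neg, map_pow, map_mul, map_ofNat]
        field_simp
      rw [harg, hψF_apply, map_smul, smul_eq_mul, ← hT] at hquad
      have hrw : -T / (4 * z) * y ^ 2 = -y ^ 2 / (4 * z) * T := by ring
      rw [hrw, ← hquad, mul_sum]
      refine sum_congr rfl fun x _ => ?_
      rw [zetaP_eq_stdAddChar, hψF_apply, ← AddChar.map_add_eq_mul, sub_eq_neg_add]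
    have hne : -T / (4 * z) ≠ 0 := div_ne_zero (neg_ne_zero.mpr hTra) (mul_ne_zero h4 hz0)
    have hchar : quadraticChar (ZMod p) z * quadraticChar (ZMod p) (-T / (4 * z))
        = quadraticChar (ZMod p) (-T) := by
      have h : z * (-T / (4 * z)) * 2 ^ 2 = -T := by
        field_simp
        norm_num
      conv_rhs => rw [← h, map_mul, map_mul, quadraticChar_sq_one' h2, mul_one]
    rw [sum_congr rfl fun y _ => hx y, ← mul_sum, ← sum_mul, sum_addChar_mul_sq hp hψ hne,
      ← hchar]
    push_cast
    ring
  have hsum : ∑ z ∈ univ.filter (fun z : ZMod p => z ≠ 0), ψ (-(z * ρ)) = -1 := by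
    have h := AddChar.sum_eq_zero_of_ne_one (AddChar.IsPrimitive.of_ne_one hψ (neg_ne_zero.mpr hρ))
    rw [← sum_filter_add_sum_filter_not univ (fun z : ZMod p => z ≠ 0)] at h
    simp only [AddChar.mulShift_apply, not_not, filter_eq', mem_univ, if_true, sum_singleton,
      mul_zero, AddChar.map_zero_eq_one] at h
    rw [← eq_neg_iff_add_eq_zero.mpr h]
    exact sum_congr rfl fun z _ => by rw [neg_mul, mul_comm]
  have hpodd : p % 2 = 1 := (Fact.out : p.Prime).eq_two_or_odd.resolve_left hp2
  have hneg : quadraticChar (ZMod p) (-1) = (-1) ^ ((p - 1) / 2) := by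
    rw [quadraticChar_neg_one hp, ZMod.card, ZMod.χ₄_eq_neg_one_pow hpodd]
    congr 1
    omega
  obtain ⟨l, rfl⟩ := hmodd
  have hg : g ^ (2 * l + 1 + 1) = (quadraticChar (ZMod p) (-1) * (p : ℤ) : ℤ) ^ (l + 1) := by
    have h := gaussSum_complexQuadraticChar_sq hp hψ
    rw [ZMod.card] at h
    rw [show 2 * l + 1 + 1 = 2 * (l + 1) by ring, pow_mul, h]
    push_cast
    rfl
  rw [sum_congr rfl hinner, ← sum_mul, hsum, hg, neg_eq_neg_one_mul T,
    map_mul (quadraticChar (ZMod p)), show (2 * l + 1 - 1) / 2 = l by omega,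
    show (2 * l + 1 + 1) / 2 = l + 1 by omega, pow_mul, ← hneg]
  have hsq : (quadraticChar (ZMod p) (-1) : ℂ) ^ 2 = 1 := by
    have := quadraticChar_sq_one (neg_ne_zero.mpr (one_ne_zero (α := ZMod p)))
    exact_mod_cast this
  push_cast
  linear_combination (-(quadraticChar (ZMod p) (-1) : ℂ) ^ l * quadraticChar F a *
    quadraticChar (ZMod p) T * (p : ℂ) ^ (l + 1)) * hsq
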